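/- arXiv:2202.08828 — 2 statements merged into one kernel-verified Lean document; each statement's English description precedes it below -/
import Mathlib

section
/- For every finite simple graph G and all integers 1 ≤ ℓ ≤ k ≤ r_G, the polynomial m_ℓ(G,x) · m_k(G,x) − m_{ℓ-1}(G,x) · m_{k+1}(G,x) in the polynomial ring F[x_e : e ∈ E(G)] has nonnegative coefficients, where nonnegative means each coefficient is a nonnegative rational number (equivalently, a nonnegative integer). -/
/-- A matching on `G`, given as a finite set of elements of the edge set of `G` that are
pairwise disjoint (no two distinct edges share a vertex). -/
def IsEdgeMatching {V : Type*} (G : SimpleGraph V) (M : Finset G.edgeSet) : Prop :=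
  ∀ e ∈ M, ∀ f ∈ M, e ≠ f → ∀ v, v ∈ (e : Sym2 V) → v ∉ (f : Sym2 V)

/-- `r_G`, the size of a maximum matching of `G`. -/
noncomputable def maxMatchingSize {V : Type*} (G : SimpleGraph V) : ℕ :=
  sSup {k : ℕ | ∃ M : Finset G.edgeSet, IsEdgeMatching G M ∧ M.card = k}

open Classical in
/-- The `k`-th weighted matching polynomial `m_k(G, x) = Σ_M Π_{e ∈ M} x_e`, the sum over
all matchings `M` of size `k` on `G`, in the polynomial ring over `ℚ` with variables
indexed by the edges of `G`. -/
noncomputable def weightedMatchingPoly {V : Type*} [Fintype V] (G : SimpleGraph V)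
    (k : ℕ) : MvPolynomial G.edgeSet ℚ :=
  ∑ M ∈ Finset.univ.filter
      (fun M : Finset G.edgeSet => IsEdgeMatching G M ∧ M.card = k),
    ∏ e ∈ M, MvPolynomial.X e

section

open Finset

namespace SimpleGraph

open Classical in
theorem Connected.card_le_two_mul_card_cover_add_one {K : Type*} [Fintype K] {H : SimpleGraph K}
    (hc : H.Connected) (hdeg : ∀ v, H.degree v ≤ 2) (A : Finset K)
    (hA : ∀ u v, H.Adj u v → u ∈ A ∨ v ∈ A) : Fintype.card K ≤ 2 * #A + 1 := by
  have h1 := hc.card_vert_le_card_edgeSet_add_one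
  rw [Nat.card_eq_fintype_card, Nat.card_eq_fintype_card, ← edgeFinset_card] at h1
  have h2 : H.edgeFinset ⊆ A.biUnion fun v => H.incidenceFinset v := by
    intro e he
    induction e with | _ u v
    rw [mem_edgeFinset, mem_edgeSet] at he
    rw [mem_biUnion]
    rcases hA u v he with h | h
    · exact ⟨u, h, by simpa [mem_incidenceFinset, mem_incidenceSet] using he⟩
    · exact ⟨v, h, by
        rw [Sym2.eq_swap]; simpa [mem_incidenceFinset, mem_incidenceSet] using he.symm⟩
  have h3 : #(A.biUnion fun v => H.incidenceFinset v) ≤ #A * 2 :=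
    card_biUnion_le_card_mul _ _ _ fun v _ => by
      rw [card_incidenceFinset_eq_degree]; exact hdeg v
  have := card_le_card h2
  omega

open Classical in
theorem ConnectedComponent.card_le_two_mul_card_cover_add_one {S : Type*} [Fintype S]
    {H : SimpleGraph S} (hdeg : ∀ v, H.degree v ≤ 2) (A : Finset S)
    (hA : ∀ u v, H.Adj u v → u ∈ A ∨ v ∈ A) (c : H.ConnectedComponent) :
    #{v | H.connectedComponentMk v = c} ≤ 2 * #{v ∈ A | H.connectedComponentMk v = c} + 1 := by
  have hd : ∀ v, c.toSimpleGraph.degree v ≤ 2 := fun v => by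
    refine le_trans ?_ (hdeg v)
    rw [← card_neighborFinset_eq_degree, ← card_neighborFinset_eq_degree]
    refine card_le_card_of_injOn Subtype.val (fun w hw => ?_) Subtype.val_injective.injOn
    rw [mem_coe, mem_neighborFinset] at hw ⊢
    exact hw
  have h := c.connected_toSimpleGraph.card_le_two_mul_card_cover_add_one hd
    (A.subtype (· ∈ c.supp)) fun u v huv => by simpa using hA u v huv
  rw [card_subtype] at h
  have h' : Fintype.card c = #{v | H.connectedComponentMk v = c} := by
    rw [Fintype.card_subtype]
    rfl
  rw [h'] at h
  convert h
  rfl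

/-- The number of vertices of `c` in `A` minus the number of vertices of `c` outside `A`. -/
noncomputable def excess {S : Type*} [Fintype S] (H : SimpleGraph S) (A : Finset S)
    (c : H.ConnectedComponent) : ℤ :=
  open Classical in ∑ v with H.connectedComponentMk v = c, if v ∈ A then 1 else -1

/-- Exchange membership in `A` on the connected component `c`. -/
noncomputable def flip {S : Type*} [Fintype S] (H : SimpleGraph S) (A : Finset S)
    (c : H.ConnectedComponent) : Finset S :=
  open Classical in {v | v ∈ A ↔ H.connectedComponentMk v ≠ c}

/-- `A` and its complement are independent, i.e. they form a proper two-colouring. -/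
def IsSide {S : Type*} (H : SimpleGraph S) (A : Finset S) : Prop :=
  ∀ u v, H.Adj u v → (u ∈ A ↔ v ∉ A)

section

variable {S : Type*} [Fintype S] {H : SimpleGraph S} {A : Finset S}

theorem mem_flip {c : H.ConnectedComponent} {v : S} :
    v ∈ H.flip A c ↔ (v ∈ A ↔ H.connectedComponentMk v ≠ c) := by
  classical simp [flip]

theorem flip_flip (c : H.ConnectedComponent) : H.flip (H.flip A c) c = A := by
  ext v
  simp only [mem_flip]
  tauto

theorem IsSide.flip (hA : H.IsSide A) (c : H.ConnectedComponent) : H.IsSide (H.flip A c) := by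
  intro u v huv
  have h1 := hA u v huv
  have h2 : H.connectedComponentMk u = H.connectedComponentMk v :=
    ConnectedComponent.sound huv.reachable
  simp only [mem_flip, h2]
  tauto

theorem excess_flip (c : H.ConnectedComponent) : H.excess (H.flip A c) c = - H.excess A c := by
  classical
  simp only [excess]
  rw [← sum_neg_distrib]
  refine sum_congr rfl fun v hv => ?_
  have : H.connectedComponentMk v = c := by simpa using hv
  by_cases h : v ∈ A <;> simp [mem_flip, h, this]

theorem sum_ite_mem_one_neg_one [DecidableEq S] (A : Finset S) :
    ∑ v, (if v ∈ A then 1 else -1 : ℤ) = 2 * #A - Fintype.card S := by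
  have : ∀ v, (if v ∈ A then 1 else -1 : ℤ) = 2 * (if v ∈ A then 1 else 0) - 1 := fun v => by
    split_ifs <;> rfl
  simp only [this, sum_sub_distrib, ← mul_sum]
  simp

open Classical in
theorem sum_excess : ∑ c, H.excess A c = 2 * #A - Fintype.card S := by
  rw [← sum_ite_mem_one_neg_one]
  exact sum_fiberwise _ _ _

theorem card_flip (c : H.ConnectedComponent) : (#(H.flip A c) : ℤ) = #A - H.excess A c := by
  classical
  have h1 := sum_ite_mem_one_neg_one A
  have h2 := sum_ite_mem_one_neg_one (H.flip A c)
  have h3 : ∑ v, (if v ∈ H.flip A c then 1 else -1 : ℤ) =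
      ∑ v, (if v ∈ A then 1 else -1 : ℤ) - 2 * H.excess A c := by
    rw [excess, sum_filter, mul_sum, ← sum_sub_distrib]
    refine sum_congr rfl fun v _ => ?_
    by_cases h : v ∈ A <;> by_cases h' : H.connectedComponentMk v = c <;>
      simp [mem_flip, h, h']
  linarith

open Classical in
theorem excess_eq (c : H.ConnectedComponent) : H.excess A c =
    2 * #{v ∈ A | H.connectedComponentMk v = c} - #{v | H.connectedComponentMk v = c} := by
  have : ∀ v, (if v ∈ A then 1 else -1 : ℤ) = 2 * (if v ∈ A then 1 else 0) - 1 := fun v => by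
    split_ifs <;> rfl
  simp only [excess, this, sum_sub_distrib, ← mul_sum]
  simp only [sum_boole, sum_const, filter_filter]
  have h : ({v | H.connectedComponentMk v = c ∧ v ∈ A} : Finset S) =
      {v ∈ A | H.connectedComponentMk v = c} := by
    ext v
    simp [and_comm]
  rw [h]
  simp

open Classical in
theorem IsSide.excess_mem (hdeg : ∀ v, H.degree v ≤ 2) (hA : H.IsSide A)
    (c : H.ConnectedComponent) :
    H.excess A c = -1 ∨ H.excess A c = 0 ∨ H.excess A c = 1 := by
  have h1 := c.card_le_two_mul_card_cover_add_one hdeg A fun u v huv => by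
    have := hA u v huv; tauto
  have h2 := c.card_le_two_mul_card_cover_add_one hdeg Aᶜ fun u v huv => by
    have := hA u v huv; simp only [mem_compl]; tauto
  have h3 : #{v | H.connectedComponentMk v = c} =
      #{v ∈ A | H.connectedComponentMk v = c} + #{v ∈ Aᶜ | H.connectedComponentMk v = c} := by
    rw [← card_union_of_disjoint
      (disjoint_filter_filter disjoint_compl_right), ← filter_union, union_compl]
  rw [excess_eq]
  omega

open Classical in
theorem IsSide.excess_sq (hdeg : ∀ v, H.degree v ≤ 2) (hA : H.IsSide A)
    (c : H.ConnectedComponent) :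
    H.excess A c ^ 2 = (#{v | H.connectedComponentMk v = c} : ℤ) % 2 := by
  have h1 := hA.excess_mem hdeg c
  have h2 := excess_eq (A := A) c
  rcases h1 with h | h | h <;> rw [h] at h2 ⊢ <;> norm_num <;> omega

open Classical in
theorem IsSide.two_mul_card_excess (hdeg : ∀ v, H.degree v ≤ 2) (hA : H.IsSide A) (s : ℤ)
    (hs : s = 1 ∨ s = -1) :
    (2 * #{c | H.excess A c = s} : ℤ) =
      ∑ c : H.ConnectedComponent, (#{v | H.connectedComponentMk v = c} : ℤ) % 2 +
        s * (2 * #A - Fintype.card S) := by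
  rw [← sum_excess (H := H), mul_sum, ← sum_add_distrib, ← sum_boole, mul_sum]
  refine sum_congr rfl fun c _ => ?_
  rw [← hA.excess_sq hdeg c]
  rcases hs with rfl | rfl <;> rcases hA.excess_mem hdeg c with h | h | h <;> rw [h] <;> norm_num

open Classical in
/-- In a graph of maximum degree at most two, the number of proper two-colourings whose first class
has a given size increases up to half of the number of vertices. -/
theorem card_isSide_le_card_isSide_succ (hdeg : ∀ v, H.degree v ≤ 2) {j : ℕ}
    (hj : 2 * (j + 1) ≤ Fintype.card S) :
    #{A : Finset S | H.IsSide A ∧ #A = j} ≤ #{A : Finset S | H.IsSide A ∧ #A = j + 1} := by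
  set P := ({A : Finset S | H.IsSide A ∧ #A = j} : Finset (Finset S)) with hP
  set Q := ({A : Finset S | H.IsSide A ∧ #A = j + 1} : Finset (Finset S)) with hQ
  set o : ℤ := ∑ c : H.ConnectedComponent, (#{v | H.connectedComponentMk v = c} : ℤ) % 2
  have hle : #(P.sigma fun A => {c | H.excess A c = -1}) ≤
      #(Q.sigma fun A => {c | H.excess A c = 1}) := by
    refine card_le_card_of_injOn (fun x => ⟨H.flip x.1 x.2, x.2⟩) ?_ ?_
    · rintro ⟨A, c⟩ hx
      simp only [hP, hQ, coe_sigma, Set.mem_sigma_iff, mem_coe, mem_filter, mem_univ,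
        true_and] at hx ⊢
      obtain ⟨⟨h1, h2⟩, h3⟩ := hx
      have := card_flip (A := A) c
      exact ⟨⟨h1.flip c, by omega⟩, by rw [excess_flip, h3, neg_neg]⟩
    · rintro ⟨A, c⟩ _ ⟨A', c'⟩ _ h
      simp only [Sigma.mk.injEq, heq_eq_eq] at h
      obtain ⟨h1, rfl⟩ := h
      rw [← flip_flip (A := A) c, h1, flip_flip]
  have hl : (2 * #(P.sigma fun A => {c | H.excess A c = -1}) : ℤ) =
      #P * (o + (Fintype.card S - 2 * j)) := by
    rw [card_sigma, Nat.cast_sum, mul_sum, ← nsmul_eq_mul, ← sum_const]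
    refine sum_congr rfl fun A hA => ?_
    obtain ⟨h1, h2⟩ : H.IsSide A ∧ #A = j := by simpa [hP] using hA
    rw [h1.two_mul_card_excess hdeg (-1) (.inr rfl), h2]
    ring
  have hr : (2 * #(Q.sigma fun A => {c | H.excess A c = 1}) : ℤ) =
      #Q * (o + (2 * (j + 1) - Fintype.card S)) := by
    rw [card_sigma, Nat.cast_sum, mul_sum, ← nsmul_eq_mul, ← sum_const]
    refine sum_congr rfl fun A hA => ?_
    obtain ⟨h1, h2⟩ : H.IsSide A ∧ #A = j + 1 := by simpa [hQ] using hA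
    rw [h1.two_mul_card_excess hdeg 1 (.inl rfl), h2]
    push_cast
    ring
  by_contra! hlt
  have ho : 0 < o + (Fintype.card S - 2 * j) := by
    have : 0 ≤ o := sum_nonneg fun c _ => Int.emod_nonneg _ two_ne_zero
    omega
  have hle' : (#P * (o + (Fintype.card S - 2 * j)) : ℤ) ≤
      #Q * (o + (2 * (j + 1) - Fintype.card S)) := by
    rw [← hl, ← hr]; exact_mod_cast Nat.mul_le_mul_left 2 hle
  have hlt' : (#Q : ℤ) < #P := by exact_mod_cast hlt
  have : (#Q : ℤ) * (o + (2 * (j + 1) - Fintype.card S)) ≤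
      #Q * (o + (Fintype.card S - 2 * j)) :=
    mul_le_mul_of_nonneg_left (by omega) (by positivity)
  nlinarith

end

end SimpleGraph

open Classical in
/-- Ordered pairs of matchings of sizes `a` and `b` whose indicator functions add up to `d`. -/
noncomputable def matchingPairs {V : Type*} [Fintype V] (G : SimpleGraph V)
    (d : G.edgeSet →₀ ℕ) (a b : ℕ) : Finset (Finset G.edgeSet × Finset G.edgeSet) :=
  {p | IsEdgeMatching G p.1 ∧ #p.1 = a ∧ IsEdgeMatching G p.2 ∧ #p.2 = b ∧
    ∀ e, (if e ∈ p.1 then 1 else 0) + (if e ∈ p.2 then 1 else 0) = d e}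

open Classical in
theorem weightedMatchingPoly_mul_coeff {V : Type*} [Fintype V] (G : SimpleGraph V) (a b : ℕ)
    (d : G.edgeSet →₀ ℕ) :
    (weightedMatchingPoly G a * weightedMatchingPoly G b).coeff d =
      #(matchingPairs G d a b) := by
  have hX : ∀ M : Finset G.edgeSet, ∏ e ∈ M, (MvPolynomial.X e : MvPolynomial G.edgeSet ℚ) =
      MvPolynomial.monomial (∑ e ∈ M, Finsupp.single e 1) 1 := fun M => by
    rw [MvPolynomial.monomial_sum_one]
    rfl
  simp only [weightedMatchingPoly, hX, sum_mul_sum, MvPolynomial.coeff_sum,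
    MvPolynomial.monomial_mul, MvPolynomial.coeff_monomial, mul_one]
  rw [← sum_product', sum_boole, matchingPairs]
  congr 2
  ext ⟨M, N⟩
  simp only [mem_filter, mem_product, mem_univ, true_and, DFunLike.ext_iff, Finsupp.add_apply,
    Finsupp.finsetSum_apply, Finsupp.single_apply, sum_ite_eq', and_assoc]

theorem isEdgeMatching_iff {V : Type*} {G : SimpleGraph V} {M : Finset G.edgeSet} :
    IsEdgeMatching G M ↔ ∀ e ∈ M, ∀ f ∈ M, ¬ G.lineGraph.Adj e f := by
  simp only [IsEdgeMatching, SimpleGraph.lineGraph_adj_iff_exists, not_and, not_exists]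

theorem IsEdgeMatching.card_le_two {V : Type*} {G : SimpleGraph V} {N T : Finset G.edgeSet}
    (hN : IsEdgeMatching G N) (e : G.edgeSet) (hTN : T ⊆ N)
    (hT : ∀ f ∈ T, G.lineGraph.Adj e f) : #T ≤ 2 := by
  classical
  refine le_trans (card_le_card_of_forall_subsingleton (t := (e : Sym2 V).toFinset)
    (fun (f : G.edgeSet) v => v ∈ (f : Sym2 V)) (fun f hf => ?_) fun v _ f hf f' hf' => ?_) ?_
  · obtain ⟨-, v, hv⟩ := SimpleGraph.lineGraph_adj_iff_exists.1 (hT f hf)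
    exact ⟨v, Sym2.mem_toFinset.2 hv.1, hv.2⟩
  · by_contra h
    exact hN f (hTN hf.1) f' (hTN hf'.1) h v hf.2 hf'.2
  · rw [Sym2.card_toFinset]
    split_ifs <;> omega

theorem mem_matchingPairs {V : Type*} [Fintype V] {G : SimpleGraph V} {d : G.edgeSet →₀ ℕ}
    {a b : ℕ} {p : Finset G.edgeSet × Finset G.edgeSet} [DecidableEq G.edgeSet] :
    p ∈ matchingPairs G d a b ↔ IsEdgeMatching G p.1 ∧ #p.1 = a ∧ IsEdgeMatching G p.2 ∧
      #p.2 = b ∧ ∀ e, (if e ∈ p.1 then 1 else 0) + (if e ∈ p.2 then 1 else 0) = d e := by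
  simp only [matchingPairs, mem_filter, mem_univ, true_and]
  congr!

/-- The conflict graph on the edges occurring exactly once in a pair of matchings. -/
abbrev singleEdgeGraph {V : Type*} (G : SimpleGraph V) (d : G.edgeSet →₀ ℕ) :
    SimpleGraph {e : G.edgeSet // d e = 1} :=
  G.lineGraph.comap Subtype.val

section

variable {V : Type*} [Fintype V] {G : SimpleGraph V} {d : G.edgeSet →₀ ℕ} {a b : ℕ}
  {M N : Finset G.edgeSet}

theorem mem_iff_notMem_of_mem_matchingPairs (h : (M, N) ∈ matchingPairs G d a b) {e : G.edgeSet}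
    (he : d e = 1) : e ∈ M ↔ e ∉ N := by
  classical
  have := (mem_matchingPairs.1 h).2.2.2.2 e
  by_cases h1 : e ∈ M <;> by_cases h2 : e ∈ N <;> simp_all

theorem mem_and_mem_of_mem_matchingPairs (h : (M, N) ∈ matchingPairs G d a b) {e : G.edgeSet}
    (he : d e = 2) : e ∈ M ∧ e ∈ N := by
  classical
  have := (mem_matchingPairs.1 h).2.2.2.2 e
  by_cases h1 : e ∈ M <;> by_cases h2 : e ∈ N <;> simp_all

theorem mem_or_mem_iff_of_mem_matchingPairs (h : (M, N) ∈ matchingPairs G d a b) {e : G.edgeSet} :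
    e ∈ M ∨ e ∈ N ↔ d e = 1 ∨ d e = 2 := by
  classical
  have := (mem_matchingPairs.1 h).2.2.2.2 e
  by_cases h1 : e ∈ M <;> by_cases h2 : e ∈ N <;> simp_all
  omega

open Classical in
theorem degree_singleEdgeGraph_le_two (h : (M, N) ∈ matchingPairs G d a b)
    (e : {e : G.edgeSet // d e = 1}) : (singleEdgeGraph G d).degree e ≤ 2 := by
  obtain ⟨hM, -, hN, -, -⟩ := mem_matchingPairs.1 h
  have key : ∀ L : Finset G.edgeSet, IsEdgeMatching G L →
      (∀ f, (singleEdgeGraph G d).Adj e f → f.1 ∈ L) → (singleEdgeGraph G d).degree e ≤ 2 := by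
    intro L hL hf
    rw [← SimpleGraph.card_neighborFinset_eq_degree,
      ← card_map (Function.Embedding.subtype _)]
    refine hL.card_le_two e (fun f hfm => ?_) fun f hfm => ?_ <;>
      obtain ⟨f, hfe, rfl⟩ := mem_map.1 hfm
    · exact hf f ((SimpleGraph.mem_neighborFinset (singleEdgeGraph G d) _ _).1 hfe)
    · exact (SimpleGraph.mem_neighborFinset (singleEdgeGraph G d) _ _).1 hfe
  have he := mem_iff_notMem_of_mem_matchingPairs h e.2
  by_cases heM : e.1 ∈ M
  · refine key N hN fun f hf => by_contra fun hfN => ?_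
    exact isEdgeMatching_iff.1 hM e heM f
      ((mem_iff_notMem_of_mem_matchingPairs h f.2).2 hfN) hf
  · refine key M hM fun f hf => by_contra fun hfM => ?_
    have hf' := mem_iff_notMem_of_mem_matchingPairs h f.2
    exact isEdgeMatching_iff.1 hN e (not_not.1 (mt he.2 heM)) f (not_not.1 (mt hf'.2 hfM)) hf

theorem isSide_subtype (h : (M, N) ∈ matchingPairs G d a b) :
    (singleEdgeGraph G d).IsSide (M.subtype (d · = 1)) := by
  classical
  obtain ⟨hM, -, hN, -, -⟩ := mem_matchingPairs.1 h
  intro u v huv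
  have h1 := isEdgeMatching_iff.1 hM u
  have h2 := isEdgeMatching_iff.1 hN u
  have h3 := mem_iff_notMem_of_mem_matchingPairs h u.2
  have h4 := mem_iff_notMem_of_mem_matchingPairs h v.2
  have h5 : G.lineGraph.Adj u.1 v.1 := huv
  simp only [mem_subtype]
  constructor
  · exact fun hu hv => h1 hu v hv h5
  · intro hv
    by_contra hu
    exact h2 (not_not.1 (mt h3.2 hu)) v (not_not.1 (mt h4.2 hv)) h5

open Classical in
theorem card_fst_of_mem_matchingPairs (h : (M, N) ∈ matchingPairs G d a b) :
    a = #(M.subtype (d · = 1)) + #{e | d e = 2} := by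
  rw [← (mem_matchingPairs.1 h).2.1, card_subtype, ← card_union_of_disjoint]
  · congr 1
    ext e
    have h1 := mem_or_mem_iff_of_mem_matchingPairs (e := e) h
    have h2 := mem_and_mem_of_mem_matchingPairs (e := e) h
    simp only [mem_union, mem_filter, mem_univ, true_and]
    tauto
  · rw [disjoint_left]
    intro e h1 h2
    simp only [mem_filter, mem_univ, true_and] at h1 h2
    omega

theorem swap_mem_matchingPairs (h : (M, N) ∈ matchingPairs G d a b) :
    (N, M) ∈ matchingPairs G d b a := by
  classical
  obtain ⟨h1, h2, h3, h4, h5⟩ := mem_matchingPairs.1 h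
  exact mem_matchingPairs.2 ⟨h3, h4, h1, h2, fun e => by rw [add_comm]; exact h5 e⟩

open Classical in
theorem compl_subtype_eq (h : (M, N) ∈ matchingPairs G d a b) :
    (M.subtype (d · = 1))ᶜ = N.subtype (d · = 1) := by
  ext e
  have := mem_iff_notMem_of_mem_matchingPairs h e.2
  simp only [mem_compl, mem_subtype]
  tauto

/-- The matching consisting of the edges in `A` and of all edges occurring twice. -/
noncomputable def addDoubleEdges (d : G.edgeSet →₀ ℕ) (A : Finset {e : G.edgeSet // d e = 1}) :
    Finset G.edgeSet :=
  open Classical in {e | d e = 2 ∨ ∃ h : d e = 1, ⟨e, h⟩ ∈ A}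

theorem mem_addDoubleEdges {A : Finset {e : G.edgeSet // d e = 1}} {e : G.edgeSet} :
    e ∈ addDoubleEdges d A ↔ d e = 2 ∨ ∃ h : d e = 1, ⟨e, h⟩ ∈ A := by
  simp [addDoubleEdges]

theorem subtype_addDoubleEdges (A : Finset {e : G.edgeSet // d e = 1}) :
    (addDoubleEdges d A).subtype (d · = 1) = A := by
  ext ⟨e, he⟩
  simp [mem_addDoubleEdges, he]

theorem addDoubleEdges_subtype (h : (M, N) ∈ matchingPairs G d a b) :
    addDoubleEdges d (M.subtype (d · = 1)) = M := by
  ext e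
  have h1 := mem_or_mem_iff_of_mem_matchingPairs (e := e) h
  have h2 := mem_and_mem_of_mem_matchingPairs (e := e) h
  simp only [mem_addDoubleEdges, mem_subtype, exists_prop]
  tauto

theorem addDoubleEdges_isEdgeMatching (h : (M, N) ∈ matchingPairs G d a b)
    {A : Finset {e : G.edgeSet // d e = 1}}
    (hA : ∀ e ∈ A, ∀ f ∈ A, ¬ (singleEdgeGraph G d).Adj e f) :
    IsEdgeMatching G (addDoubleEdges d A) := by
  classical
  obtain ⟨hM, -, hN, -, -⟩ := mem_matchingPairs.1 h
  have key : ∀ e f, d e = 2 → (d f = 1 ∨ d f = 2) → ¬ G.lineGraph.Adj e f := by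
    intro e f he hf
    obtain ⟨h1, h2⟩ := mem_and_mem_of_mem_matchingPairs h he
    rcases (mem_or_mem_iff_of_mem_matchingPairs h).2 hf with hf | hf
    · exact isEdgeMatching_iff.1 hM e h1 f hf
    · exact isEdgeMatching_iff.1 hN e h2 f hf
  rw [isEdgeMatching_iff]
  intro e he f hf hef
  rw [mem_addDoubleEdges] at he hf
  rcases he with he | ⟨he, heA⟩
  · exact key e f he (hf.symm.imp_left fun h => h.1) hef
  · rcases hf with hf | ⟨hf, hfA⟩
    · exact key f e hf (.inl he) hef.symm
    · exact hA _ heA _ hfA hef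

open Classical in
theorem addDoubleEdges_mem_matchingPairs {a' b' : ℕ} (h : (M, N) ∈ matchingPairs G d a b)
    {A : Finset {e : G.edgeSet // d e = 1}} (hA : (singleEdgeGraph G d).IsSide A)
    (ha : #A + #{e | d e = 2} = a') (hb : #Aᶜ + #{e | d e = 2} = b') :
    (addDoubleEdges d A, addDoubleEdges d Aᶜ) ∈ matchingPairs G d a' b' := by
  have hcard : ∀ B : Finset {e : G.edgeSet // d e = 1},
      #(addDoubleEdges d B) = #B + #{e | d e = 2} := by
    intro B
    rw [← card_map (s := B) (Function.Embedding.subtype _), ← card_union_of_disjoint]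
    · congr 1
      ext e
      simp [mem_addDoubleEdges, or_comm]
    · rw [disjoint_left]
      intro e h1 h2
      obtain ⟨e, -, rfl⟩ := mem_map.1 h1
      have h3 := e.2
      simp only [Function.Embedding.subtype_apply, mem_filter, mem_univ, true_and] at h2
      omega
  refine mem_matchingPairs.2 ⟨addDoubleEdges_isEdgeMatching h fun e he f hf hef => ?_,
    (hcard _).trans ha, addDoubleEdges_isEdgeMatching h fun e he f hf hef => ?_,
    (hcard _).trans hb, fun e => ?_⟩
  · exact (hA e f hef).1 he hf
  · exact mem_compl.1 he ((hA e f hef).2 (mem_compl.1 hf))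
  · have h0 := (mem_matchingPairs.1 h).2.2.2.2 e
    have h1 : d e = 0 ∨ d e = 1 ∨ d e = 2 := by
      rw [← h0]
      split_ifs <;> simp
    rcases h1 with h1 | h1 | h1
    · simp [mem_addDoubleEdges, h1]
    · by_cases heA : ⟨e, h1⟩ ∈ A <;> simp [mem_addDoubleEdges, h1, heA]
    · simp [mem_addDoubleEdges, h1]

end

open Classical in
theorem card_matchingPairs_le {V : Type*} [Fintype V] {G : SimpleGraph V} (d : G.edgeSet →₀ ℕ)
    {a b : ℕ} (hab : a + 1 ≤ b) :
    #(matchingPairs G d a (b + 1)) ≤ #(matchingPairs G d (a + 1) b) := by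
  rcases (matchingPairs G d a (b + 1)).eq_empty_or_nonempty with h0 | ⟨⟨M, N⟩, h⟩
  · simp [h0]
  have hM := card_fst_of_mem_matchingPairs h
  have hN := card_fst_of_mem_matchingPairs (swap_mem_matchingPairs h)
  have hS := card_add_card_compl (M.subtype (d · = 1))
  rw [compl_subtype_eq h] at hS
  set j := #(M.subtype (d · = 1))
  calc #(matchingPairs G d a (b + 1))
      ≤ #{A : Finset {e : G.edgeSet // d e = 1} | (singleEdgeGraph G d).IsSide A ∧ #A = j} := by
        refine card_le_card_of_injOn (fun p => p.1.subtype (d · = 1)) ?_ ?_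
        · rintro ⟨M', N'⟩ h'
          have := card_fst_of_mem_matchingPairs h'
          simp only [coe_filter, mem_univ, true_and, Set.mem_ofPred_eq]
          exact ⟨isSide_subtype h', by omega⟩
        · rintro ⟨M₁, N₁⟩ h₁ ⟨M₂, N₂⟩ h₂ heq
          rw [← addDoubleEdges_subtype h₁, ← addDoubleEdges_subtype h₂,
            ← addDoubleEdges_subtype (swap_mem_matchingPairs h₁),
            ← addDoubleEdges_subtype (swap_mem_matchingPairs h₂),
            ← compl_subtype_eq h₁, ← compl_subtype_eq h₂]
          exact congrArg (fun A => (addDoubleEdges d A, addDoubleEdges d Aᶜ)) heq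
    _ ≤ #{A : Finset {e : G.edgeSet // d e = 1} |
          (singleEdgeGraph G d).IsSide A ∧ #A = j + 1} :=
        SimpleGraph.card_isSide_le_card_isSide_succ (degree_singleEdgeGraph_le_two h) (by omega)
    _ ≤ #(matchingPairs G d (a + 1) b) := by
        refine card_le_card_of_injOn (fun A => (addDoubleEdges d A, addDoubleEdges d Aᶜ)) ?_ ?_
        · intro A hA
          simp only [coe_filter, mem_univ, true_and, Set.mem_ofPred_eq] at hA
          have := card_add_card_compl A
          exact addDoubleEdges_mem_matchingPairs h hA.1 (by omega) (by omega)
        · intro A _ B _ hAB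
          rw [← subtype_addDoubleEdges A, ← subtype_addDoubleEdges B]
          exact congrArg (fun p => p.1.subtype (d · = 1)) hAB

end

/-- **Weighted log-concavity of matchings (Krattenthaler).** For a finite simple graph `G`
and `1 ≤ ℓ ≤ k ≤ r_G`, the polynomial `m_ℓ(G,x)·m_k(G,x) − m_{ℓ-1}(G,x)·m_{k+1}(G,x)`
has nonnegative coefficients. -/
theorem weightedMatchingPoly_log_concave
    (V : Type) [Fintype V] [DecidableEq V] (G : SimpleGraph V)
    (ℓ k : ℕ) (hℓ : 1 ≤ ℓ) (hℓk : ℓ ≤ k) (hk : k ≤ maxMatchingSize G) :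
    ∀ d : G.edgeSet →₀ ℕ,
      0 ≤ (weightedMatchingPoly G ℓ * weightedMatchingPoly G k -
            weightedMatchingPoly G (ℓ - 1) * weightedMatchingPoly G (k + 1)).coeff d := by
  intro d
  obtain ⟨a, rfl⟩ : ∃ a, ℓ = a + 1 := ⟨ℓ - 1, by omega⟩
  rw [MvPolynomial.coeff_sub, weightedMatchingPoly_mul_coeff, weightedMatchingPoly_mul_coeff,
    sub_nonneg, Nat.add_sub_cancel]
  exact_mod_cast card_matchingPairs_le d hℓk
end

section
/- For every finite simple graph G and all integers 1 ≤ ℓ ≤ k, there exists an injective, Aut(G)-equivariant F-linear map Φ : V_{ℓ-1} ⊗ V_{k+1} → V_{ℓ} ⊗ V_{k} such that Π_{ℓ,k} ∘ Φ = Π_{ℓ-1,k+1}, i.e., the triangle formed by Φ, Π_{ℓ-1,k+1}, and Π_{ℓ,k} commutes. -/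
/-- The matchings of size `k` on `G`. -/
def Matchings {V : Type*} (G : SimpleGraph V) (k : ℕ) : Type _ :=
  {M : Finset G.edgeSet // IsEdgeMatching G M ∧ M.card = k}

/-- `V_k`, the `F`-vector space with basis the `k`-matchings of `G`. -/
abbrev MatchRep (F : Type*) [Field F] {V : Type*} (G : SimpleGraph V) (k : ℕ) : Type _ :=
  Matchings G k →₀ F

open Classical in
/-- The action of a graph automorphism `σ` on `k`-matchings, via its action on edges. -/
noncomputable def matchingsMap {V : Type*} {G : SimpleGraph V} (σ : G ≃g G) {k : ℕ} :
    Matchings G k → Matchings G k :=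
  fun M => ⟨M.val.image σ.mapEdgeSet, by
    constructor
    · intro e he f hf hef v hv hv'
      simp only [Finset.mem_image] at he hf
      obtain ⟨a, ha, rfl⟩ := he
      obtain ⟨b, hb, rfl⟩ := hf
      have hab : a ≠ b := fun hE => hef (by rw [hE])
      obtain ⟨w, hw, hwv⟩ := (Sym2.mem_map).1 hv
      obtain ⟨u, hu, huv⟩ := (Sym2.mem_map).1 hv'
      have : u = w := σ.injective (huv.trans hwv.symm)
      exact M.prop.1 a ha b hb hab w hw (this ▸ hu)
    · rw [Finset.card_image_of_injective _ σ.mapEdgeSet.injective]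
      exact M.prop.2⟩

/-- The linear action of an automorphism `σ` on `V_k`, permuting basis vectors. -/
noncomputable def actV (F : Type*) [Field F] {V : Type*} {G : SimpleGraph V}
    (σ : G ≃g G) (k : ℕ) : MatchRep F G k →ₗ[F] MatchRep F G k :=
  Finsupp.lmapDomain F F (matchingsMap σ)

/-- The `Aut(G)`-equivariant map `Π_{i,j} : V_i ⊗ V_j → F[x_e : e ∈ E(G)]` determined by
`x_M ⊗ x_{M'} ↦ (Π_{e ∈ M} x_e)(Π_{e' ∈ M'} x_{e'})`. -/
noncomputable def PiMap (F : Type*) [Field F] {V : Type*} (G : SimpleGraph V)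
    (i j : ℕ) :
    TensorProduct F (MatchRep F G i) (MatchRep F G j) →ₗ[F] MvPolynomial G.edgeSet F :=
  TensorProduct.lift <|
    Finsupp.lift (MatchRep F G j →ₗ[F] MvPolynomial G.edgeSet F) F (Matchings G i)
      (fun M => Finsupp.lift (MvPolynomial G.edgeSet F) F (Matchings G j)
        (fun M' => (∏ e ∈ M.val, MvPolynomial.X e) * ∏ e ∈ M'.val, MvPolynomial.X e))

section ClawFree

open Finset SimpleGraph
open scoped Classical symmDiff

variable {E : Type*} (L : SimpleGraph E)

/-- A graph is claw-free when every finite independent set contains at most two neighbours of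
any given vertex. -/
def ClawFree : Prop :=
  ∀ A : Finset E, L.IsIndepSet A → ∀ e, #{f ∈ A | L.Adj e f} ≤ 2

/-- The graph on the whole vertex type retaining only the edges of `L` inside `D`. -/
def restrictGraph (D : Finset E) : SimpleGraph E where
  Adj e f := L.Adj e f ∧ e ∈ D ∧ f ∈ D
  symm := ⟨fun _ _ h => ⟨h.1.symm, h.2.2, h.2.1⟩⟩
  loopless := ⟨fun _ h => h.1.ne rfl⟩

/-- The vertex sets of the connected components of the subgraph of `L` induced by `D`. -/
noncomputable def componentSets (D : Finset E) : Finset (Finset E) :=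
  D.image fun e => {f ∈ D | (restrictGraph L D).Reachable e f}

variable {L}

lemma mem_componentSets {D C : Finset E} :
    C ∈ componentSets L D ↔
      ∃ e ∈ D, {f ∈ D | (restrictGraph L D).Reachable e f} = C := by
  simp [componentSets]

lemma subset_of_mem_componentSets {D C : Finset E} (hC : C ∈ componentSets L D) : C ⊆ D := by
  obtain ⟨e, -, rfl⟩ := mem_componentSets.1 hC
  exact filter_subset _ _

lemma mem_of_adj_of_mem_componentSets {D C : Finset E} (hC : C ∈ componentSets L D)
    {e f : E} (he : e ∈ C) (hf : f ∈ D) (h : L.Adj e f) : f ∈ C := by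
  obtain ⟨a, -, rfl⟩ := mem_componentSets.1 hC
  rw [mem_filter] at he ⊢
  exact ⟨hf, he.2.trans (Adj.reachable (G := restrictGraph L D) ⟨h, he.1, hf⟩)⟩

lemma componentSets_pairwiseDisjoint (D : Finset E) :
    (componentSets L D : Set (Finset E)).PairwiseDisjoint id := by
  intro C hC C' hC' hne
  obtain ⟨a, -, rfl⟩ := mem_componentSets.1 hC
  obtain ⟨b, -, rfl⟩ := mem_componentSets.1 hC'
  rw [Function.onFun, id, id, Finset.disjoint_left]
  intro e he he'
  rw [mem_filter] at he he'
  have hab := he.2.trans he'.2.symm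
  refine hne (filter_congr fun f _ => ?_)
  exact ⟨hab.symm.trans, hab.trans⟩

lemma biUnion_componentSets (D : Finset E) : (componentSets L D).biUnion id = D := by
  ext e
  simp only [mem_biUnion, id]
  constructor
  · rintro ⟨C, hC, he⟩
    exact subset_of_mem_componentSets hC he
  · intro he
    exact ⟨_, mem_componentSets.2 ⟨e, he, rfl⟩, by simp [he]⟩

lemma sum_card_inter_componentSets (D A : Finset E) :
    ∑ C ∈ componentSets L D, #(C ∩ A) = #(D ∩ A) := by
  conv_rhs => rw [← biUnion_componentSets (L := L) D, biUnion_inter]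
  rw [card_biUnion]
  · rfl
  · intro C hC C' hC' hne
    exact (componentSets_pairwiseDisjoint D hC hC' hne).mono inter_subset_left inter_subset_left

lemma componentSets_image (τ : L ≃g L) (D : Finset E) :
    componentSets L (D.image τ) = (componentSets L D).image (image τ) := by
  have key (e f : E) : (restrictGraph L (D.image τ)).Reachable (τ e) (τ f) ↔
      (restrictGraph L D).Reachable e f :=
    Iso.reachable_iff (φ := (⟨τ.toEquiv, by simp [restrictGraph, τ.map_adj_iff]⟩ :
      restrictGraph L D ≃g restrictGraph L (D.image τ)))
  simp only [componentSets, image_image]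
  refine image_congr fun e _ => ?_
  ext f
  simp only [Function.comp, mem_filter, mem_image]
  constructor
  · rintro ⟨⟨f, hf, rfl⟩, h⟩
    exact ⟨f, ⟨hf, (key _ _).1 h⟩, rfl⟩
  · rintro ⟨f, ⟨hf, h⟩, rfl⟩
    exact ⟨⟨f, hf, rfl⟩, (key _ _).2 h⟩

/-- A connected graph is small if its edges are covered by few vertices of degree at most two. -/
lemma card_le_of_connected_of_cover {X : Type*} [Fintype X] {K : SimpleGraph X}
    (hK : K.Connected) (S : Finset X) (hcover : ∀ x y, K.Adj x y → x ∈ S ∨ y ∈ S)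
    (hdeg : ∀ x ∈ S, K.degree x ≤ 2) : Fintype.card X ≤ 2 * #S + 1 := by
  have h := hK.card_vert_le_card_edgeSet_add_one
  rw [Nat.card_eq_fintype_card, Nat.card_eq_fintype_card, ← edgeFinset_card] at h
  refine h.trans (Nat.succ_le_succ ?_)
  calc #K.edgeFinset ≤ #(S.biUnion fun x => K.incidenceFinset x) := by
        refine card_le_card fun e he => ?_
        induction e with | _ x y
        rw [mem_edgeFinset, mem_edgeSet] at he
        rw [mem_biUnion]
        rcases hcover x y he with hx | hy
        · exact ⟨x, hx, by simp [mem_incidenceFinset, incidenceSet, he]⟩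
        · exact ⟨y, hy, by simp [mem_incidenceFinset, incidenceSet, he]⟩
    _ ≤ ∑ x ∈ S, #(K.incidenceFinset x) := card_biUnion_le
    _ ≤ ∑ _x ∈ S, 2 := sum_le_sum fun x hx => by
        rw [card_incidenceFinset_eq_degree]; exact hdeg x hx
    _ = 2 * #S := by simp [mul_comm]

lemma componentSets_card_inter_le (hL : ClawFree L) {A B : Finset E}
    (hA : L.IsIndepSet A) (hB : L.IsIndepSet B) {C : Finset E}
    (hC : C ∈ componentSets L (A ∆ B)) : #(C ∩ B) ≤ #(C ∩ A) + 1 := by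
  have hCD := subset_of_mem_componentSets hC
  obtain ⟨e, heD, heC⟩ := mem_componentSets.1 hC
  have hmem : ∀ f, f ∈ C ↔ f ∈ ((restrictGraph L (A ∆ B)).connectedComponentMk e).supp := by
    intro f
    rw [← heC, mem_filter, ConnectedComponent.mem_supp_iff, ConnectedComponent.eq]
    refine ⟨fun h => h.2.symm, fun h => ⟨?_, h.symm⟩⟩
    obtain ⟨w⟩ := h
    cases w with
    | nil => exact heD
    | cons h _ => exact h.2.1
  set c := (restrictGraph L (A ∆ B)).connectedComponentMk e with hc
  have : Fintype c.supp := Fintype.ofFinset C hmem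
  have hcard : Fintype.card c.supp = #C := Fintype.card_of_finset' C hmem
  have hS : #({x : c.supp | (x : E) ∈ A} : Finset c.supp) = #(C ∩ A) := by
    refine card_bij (fun x _ => x) ?_ ?_ ?_
    · intro x hx
      simpa [hmem x.1] using hx
    · intro x _ y _ h
      exact Subtype.ext h
    · intro f hf
      rw [mem_inter, hmem] at hf
      exact ⟨⟨f, hf.1⟩, by simpa using hf.2, rfl⟩
  have key : Fintype.card c.supp ≤ 2 * #({x : c.supp | (x : E) ∈ A} : Finset c.supp) + 1 := by
    refine card_le_of_connected_of_cover c.connected_toSimpleGraph _ ?_ ?_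
    · intro x y hxy
      have hxy' : (restrictGraph L (A ∆ B)).Adj x.1 y.1 := hxy
      obtain ⟨h1, h2, h3⟩ := hxy'
      by_contra! hcon
      simp only [mem_filter, mem_univ, true_and] at hcon
      rw [mem_symmDiff] at h2 h3
      exact hB (by simp; tauto) (by simp; tauto) h1.ne h1
    · intro x hx
      simp only [mem_filter, mem_univ, true_and] at hx
      refine le_trans ?_ (hL B hB x)
      refine card_le_card_of_injOn (fun y => y.1) ?_ (fun y _ z _ h => Subtype.ext h)
      intro y hy
      have hxy : c.toSimpleGraph.Adj x y := by simpa using hy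
      obtain ⟨h1, h2, h3⟩ : (restrictGraph L (A ∆ B)).Adj x.1 y.1 := hxy
      rw [mem_symmDiff] at h3
      have : y.1 ∉ A := fun h => hA hx h h1.ne h1
      simp only [coe_filter, Set.mem_ofPred_eq]
      tauto
  rw [hcard, hS] at key
  have hsplit : #C = #(C ∩ A) + #(C ∩ B) := by
    rw [← card_union_of_disjoint, ← inter_union_distrib_left]
    · congr 1
      refine (inter_eq_left.2 fun f hf => ?_).symm
      have := hCD hf
      rw [mem_symmDiff] at this
      rw [mem_union]; tauto
    · rw [Finset.disjoint_left]
      intro f hf hf'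
      rw [mem_inter] at hf hf'
      have := hCD hf.1
      rw [mem_symmDiff] at this
      tauto
  omega

variable (L) in
/-- Ordered pairs of finite independent sets of `L`. -/
abbrev IndepPair : Type _ :=
  {p : Finset E × Finset E // L.IsIndepSet p.1 ∧ L.IsIndepSet p.2}

namespace IndepPair

protected lemma ext {p q : IndepPair L} (h₁ : p.1.1 = q.1.1) (h₂ : p.1.2 = q.1.2) : p = q :=
  Subtype.ext (Prod.ext h₁ h₂)

/-- The components of the symmetric difference of the two members of a pair. -/
noncomputable def comps (p : IndepPair L) : Finset (Finset E) :=
  componentSets L (p.1.1 ∆ p.1.2)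

/-- Components on which the second member exceeds the first. -/
noncomputable def up (p : IndepPair L) : Finset (Finset E) :=
  {C ∈ p.comps | #(C ∩ p.1.1) < #(C ∩ p.1.2)}

/-- Components on which the first member exceeds the second. -/
noncomputable def down (p : IndepPair L) : Finset (Finset E) :=
  {C ∈ p.comps | #(C ∩ p.1.2) < #(C ∩ p.1.1)}

lemma isIndepSet_symmDiff {A B : Finset E} (hA : L.IsIndepSet A) (hB : L.IsIndepSet B)
    {C : Finset E} (hC : C ∈ componentSets L (A ∆ B)) :
    L.IsIndepSet (A ∆ C : Finset E) := by
  have hCD := subset_of_mem_componentSets hC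
  have mixed : ∀ e f, e ∈ A → e ∉ C → f ∈ C → f ∉ A → ¬ L.Adj e f := by
    intro e f heA heC hfC hfA hef
    have hfB : f ∈ B := by have := mem_symmDiff.1 (hCD hfC); tauto
    by_cases heB : e ∈ B
    · exact hB heB hfB hef.ne hef
    · exact heC (mem_of_adj_of_mem_componentSets hC hfC
        (mem_symmDiff.2 (Or.inl ⟨heA, heB⟩)) hef.symm)
  intro e he f hf hne hef
  rw [mem_coe, mem_symmDiff] at he hf
  rcases he with he | he <;> rcases hf with hf | hf
  · exact hA he.1 hf.1 hne hef
  · exact mixed e f he.1 he.2 hf.1 hf.2 hef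
  · exact mixed f e hf.1 hf.2 he.1 he.2 hef.symm
  · have h1 := mem_symmDiff.1 (hCD he.1)
    have h2 := mem_symmDiff.1 (hCD hf.1)
    exact hB (x := e) (by rw [mem_coe]; tauto) (y := f) (by rw [mem_coe]; tauto) hne hef

/-- Exchange the two members of the pair on the component `C`. -/
noncomputable def toggle (C : Finset E) (p : IndepPair L) : IndepPair L :=
  if h : C ∈ p.comps then
    ⟨(p.1.1 ∆ C, p.1.2 ∆ C), isIndepSet_symmDiff p.2.1 p.2.2 h,
      isIndepSet_symmDiff p.2.2 p.2.1 (by rwa [symmDiff_comm])⟩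
  else p

variable {p : IndepPair L} {C C' : Finset E}

lemma toggle_fst (h : C ∈ p.comps) : (toggle C p).1.1 = p.1.1 ∆ C := by
  simp [toggle, h]

lemma toggle_snd (h : C ∈ p.comps) : (toggle C p).1.2 = p.1.2 ∆ C := by
  simp [toggle, h]

@[simp] lemma comps_toggle (C : Finset E) (p : IndepPair L) :
    (toggle C p).comps = p.comps := by
  by_cases h : C ∈ p.comps
  · rw [comps, toggle_fst h, toggle_snd h, symmDiff_symmDiff_symmDiff_comm, symmDiff_self,
      symmDiff_bot, comps]
  · simp [toggle, h]

lemma toggle_toggle (h : C ∈ p.comps) : toggle C (toggle C p) = p := by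
  have h' : C ∈ (toggle C p).comps := by simpa
  refine IndepPair.ext ?_ ?_
  · rw [toggle_fst h', toggle_fst h, symmDiff_symmDiff_cancel_right]
  · rw [toggle_snd h', toggle_snd h, symmDiff_symmDiff_cancel_right]

lemma toggle_comm (h : C ∈ p.comps) (h' : C' ∈ p.comps) :
    toggle C (toggle C' p) = toggle C' (toggle C p) := by
  have h₁ : C ∈ (toggle C' p).comps := by simpa
  have h₂ : C' ∈ (toggle C p).comps := by simpa
  refine IndepPair.ext ?_ ?_
  · rw [toggle_fst h₁, toggle_fst h', toggle_fst h₂, toggle_fst h, symmDiff_right_comm]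
  · rw [toggle_snd h₁, toggle_snd h', toggle_snd h₂, toggle_snd h, symmDiff_right_comm]

lemma inter_toggle_fst (h : C ∈ p.comps) : C ∩ (toggle C p).1.1 = C ∩ p.1.2 := by
  rw [toggle_fst h]
  ext e
  have := @subset_of_mem_componentSets _ _ _ _ h e
  simp only [mem_inter, mem_symmDiff] at this ⊢
  tauto

lemma inter_toggle_snd (h : C ∈ p.comps) : C ∩ (toggle C p).1.2 = C ∩ p.1.1 := by
  rw [toggle_snd h]
  ext e
  have := @subset_of_mem_componentSets _ _ _ _ h e
  simp only [mem_inter, mem_symmDiff] at this ⊢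
  tauto

lemma inter_toggle_of_ne (h : C ∈ p.comps) (h' : C' ∈ p.comps) (hne : C' ≠ C) :
    C' ∩ (toggle C p).1.1 = C' ∩ p.1.1 ∧ C' ∩ (toggle C p).1.2 = C' ∩ p.1.2 := by
  have hd : Disjoint C' C := componentSets_pairwiseDisjoint _ h' h hne
  rw [Finset.disjoint_left] at hd
  rw [toggle_fst h, toggle_snd h]
  constructor <;>
  · ext e
    have := @hd e
    simp only [mem_inter, mem_symmDiff]
    tauto

lemma mem_up : C ∈ p.up ↔ C ∈ p.comps ∧ #(C ∩ p.1.1) < #(C ∩ p.1.2) := mem_filter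

lemma mem_down : C ∈ p.down ↔ C ∈ p.comps ∧ #(C ∩ p.1.2) < #(C ∩ p.1.1) := mem_filter

lemma notMem_up_of_mem_down (h : C ∈ p.down) : C ∉ p.up := fun h' =>
  (mem_up.1 h').2.not_gt (mem_down.1 h).2

lemma notMem_down_of_mem_up (h : C ∈ p.up) : C ∉ p.down := fun h' =>
  notMem_up_of_mem_down h' h

lemma up_toggle (h : C ∈ p.down) : (toggle C p).up = insert C p.up := by
  rw [mem_down] at h
  ext C'
  rw [mem_insert, mem_up, mem_up, comps_toggle]
  by_cases hne : C' = C
  · subst hne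
    simp [inter_toggle_fst h.1, inter_toggle_snd h.1, h]
  · simp only [hne, false_or]
    refine and_congr_right fun h' => ?_
    rw [(inter_toggle_of_ne h.1 h' hne).1, (inter_toggle_of_ne h.1 h' hne).2]

lemma down_toggle (h : C ∈ p.up) : (toggle C p).down = insert C p.down := by
  rw [mem_up] at h
  ext C'
  rw [mem_insert, mem_down, mem_down, comps_toggle]
  by_cases hne : C' = C
  · subst hne
    simp [inter_toggle_fst h.1, inter_toggle_snd h.1, h]
  · simp only [hne, false_or]
    refine and_congr_right fun h' => ?_
    rw [(inter_toggle_of_ne h.1 h' hne).1, (inter_toggle_of_ne h.1 h' hne).2]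

lemma card_inter_snd_le (hL : ClawFree L) (h : C ∈ p.comps) :
    #(C ∩ p.1.2) ≤ #(C ∩ p.1.1) + 1 :=
  componentSets_card_inter_le hL p.2.1 p.2.2 h

lemma card_inter_fst_le (hL : ClawFree L) (h : C ∈ p.comps) :
    #(C ∩ p.1.1) ≤ #(C ∩ p.1.2) + 1 :=
  componentSets_card_inter_le hL p.2.2 p.2.1 (by rwa [symmDiff_comm])

lemma card_up_add_card_fst (hL : ClawFree L) (p : IndepPair L) :
    #p.up + #p.1.1 = #p.down + #p.1.2 := by
  have hA : ∑ C ∈ p.comps, #(C ∩ p.1.1) = #(p.1.1 \ p.1.2) := by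
    rw [comps, sum_card_inter_componentSets]
    congr 1; ext e; simp only [mem_inter, mem_symmDiff, mem_sdiff]; tauto
  have hB : ∑ C ∈ p.comps, #(C ∩ p.1.2) = #(p.1.2 \ p.1.1) := by
    rw [comps, sum_card_inter_componentSets]
    congr 1; ext e; simp only [mem_inter, mem_symmDiff, mem_sdiff]; tauto
  have h1 := card_sdiff_add_card_inter p.1.1 p.1.2
  have h2 := card_sdiff_add_card_inter p.1.2 p.1.1
  rw [inter_comm] at h2
  have key : #p.up + ∑ C ∈ p.comps, #(C ∩ p.1.1) = #p.down + ∑ C ∈ p.comps, #(C ∩ p.1.2) := by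
    rw [up, down, card_filter, card_filter, ← sum_add_distrib, ← sum_add_distrib]
    refine sum_congr rfl fun C hC => ?_
    have := card_inter_snd_le hL hC
    have := card_inter_fst_le hL hC
    split_ifs <;> omega
  omega

lemma card_symmDiff_add (A C : Finset E) : #(A ∆ C) + #(C ∩ A) = #A + #(C \ A) := by
  have h1 := card_sdiff_add_card_inter A C
  have h2 : #(A ∆ C) = #(A \ C) + #(C \ A) := by
    rw [symmDiff_def, sup_eq_union, card_union_of_disjoint disjoint_sdiff_sdiff]
  rw [inter_comm] at h1
  omega

lemma card_toggle_fst (h : C ∈ p.comps) :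
    #(toggle C p).1.1 + #(C ∩ p.1.1) = #p.1.1 + #(C ∩ p.1.2) := by
  rw [toggle_fst h, card_symmDiff_add]
  congr 2
  ext e
  have := @subset_of_mem_componentSets _ _ _ _ h e
  simp only [mem_inter, mem_symmDiff, mem_sdiff] at this ⊢
  tauto

lemma card_toggle_snd (h : C ∈ p.comps) :
    #(toggle C p).1.2 + #(C ∩ p.1.2) = #p.1.2 + #(C ∩ p.1.1) := by
  rw [toggle_snd h, card_symmDiff_add]
  congr 2
  ext e
  have := @subset_of_mem_componentSets _ _ _ _ h e
  simp only [mem_inter, mem_symmDiff, mem_sdiff] at this ⊢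
  tauto

lemma card_toggle_of_mem_up (hL : ClawFree L) (h : C ∈ p.up) :
    #(toggle C p).1.1 = #p.1.1 + 1 ∧ #(toggle C p).1.2 + 1 = #p.1.2 := by
  rw [mem_up] at h
  have := card_inter_snd_le hL h.1
  have := card_toggle_fst h.1
  have := card_toggle_snd h.1
  omega

lemma card_toggle_of_mem_down (hL : ClawFree L) (h : C ∈ p.down) :
    #(toggle C p).1.1 + 1 = #p.1.1 ∧ #(toggle C p).1.2 = #p.1.2 + 1 := by
  rw [mem_down] at h
  have := card_inter_fst_le hL h.1
  have := card_toggle_fst h.1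
  have := card_toggle_snd h.1
  omega

lemma prod_mul_prod_toggle {R : Type*} [CommMonoid R] (g : E → R) (C : Finset E)
    (p : IndepPair L) :
    (∏ e ∈ (toggle C p).1.1, g e) * ∏ e ∈ (toggle C p).1.2, g e =
      (∏ e ∈ p.1.1, g e) * ∏ e ∈ p.1.2, g e := by
  by_cases h : C ∈ p.comps
  · have key : ∀ A B : Finset E, (∏ e ∈ A, g e) * ∏ e ∈ B, g e =
        (∏ e ∈ A ∪ B, g e) * ∏ e ∈ A ∩ B, g e := fun A B => (prod_union_inter).symm
    rw [key (toggle C p).1.1, key p.1.1, toggle_fst h, toggle_snd h]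
    have hCD : ∀ e ∈ C, e ∈ p.1.1 ∆ p.1.2 := subset_of_mem_componentSets h
    congr 2 <;>
    · ext e
      have := hCD e
      simp only [mem_inter, mem_union, mem_symmDiff] at this ⊢
      tauto
  · simp [toggle, h]

/-- The action of a graph automorphism on pairs of independent sets. -/
noncomputable def map (τ : L ≃g L) (p : IndepPair L) : IndepPair L :=
  ⟨(p.1.1.image τ, p.1.2.image τ), by
    have key (A : Finset E) (hA : L.IsIndepSet A) : L.IsIndepSet (A.image τ : Finset E) := by
      rw [coe_image]
      rintro _ ⟨e, he, rfl⟩ _ ⟨f, hf, rfl⟩ hne h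
      exact hA he hf (fun h' => hne (by rw [h'])) (τ.map_adj_iff.1 h)
    exact ⟨key _ p.2.1, key _ p.2.2⟩⟩

lemma comps_map (τ : L ≃g L) (p : IndepPair L) :
    (map τ p).comps = p.comps.image (image τ) := by
  rw [comps, map, ← image_symmDiff _ _ τ.injective, componentSets_image, comps]

lemma up_map (τ : L ≃g L) (p : IndepPair L) : (map τ p).up = p.up.image (image τ) := by
  rw [up, comps_map, up, filter_image]
  congr 1
  refine filter_congr fun C _ => ?_
  simp only [map, ← image_inter _ _ τ.injective, card_image_of_injective _ τ.injective]

lemma card_up_map (τ : L ≃g L) (p : IndepPair L) : #(map τ p).up = #p.up := by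
  rw [up_map, card_image_of_injective _ (image_injective τ.injective)]

lemma sum_up_map {N : Type*} [AddCommMonoid N] (τ : L ≃g L) (p : IndepPair L)
    (g : Finset E → N) : ∑ C ∈ (map τ p).up, g C = ∑ C ∈ p.up, g (C.image τ) := by
  rw [up_map, sum_image (image_injective τ.injective).injOn]

lemma toggle_map (τ : L ≃g L) (h : C ∈ p.comps) :
    toggle (C.image τ) (map τ p) = map τ (toggle C p) := by
  have h' : C.image τ ∈ (map τ p).comps := by
    rw [comps_map]; exact mem_image_of_mem _ h
  refine IndepPair.ext ?_ ?_
  · rw [toggle_fst h']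
    simp only [map, toggle_fst h, image_symmDiff _ _ τ.injective]
  · rw [toggle_snd h']
    simp only [map, toggle_snd h, image_symmDiff _ _ τ.injective]

attribute [local instance] LieRing.ofAssociativeRing

variable (F : Type*) [Field F]

/-- The sum of all pairs obtained by toggling a component that favours the second member. -/
noncomputable def raise : Module.End F (IndepPair L →₀ F) :=
  Finsupp.linearCombination F fun p => ∑ C ∈ p.up, Finsupp.single (toggle C p) 1

/-- The sum of all pairs obtained by toggling a component that favours the first member. -/
noncomputable def lower : Module.End F (IndepPair L →₀ F) :=
  Finsupp.linearCombination F fun p => ∑ C ∈ p.down, Finsupp.single (toggle C p) 1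

/-- The diagonal operator multiplying a pair by the difference of the sizes of its members. -/
noncomputable def weight : Module.End F (IndepPair L →₀ F) :=
  Finsupp.linearCombination F fun p => ((#p.1.1 : F) - #p.1.2) • Finsupp.single p 1

variable {F}

lemma raise_single (p : IndepPair L) :
    raise F (Finsupp.single p 1) = ∑ C ∈ p.up, Finsupp.single (toggle C p) 1 := by
  simp [raise]

lemma lower_single (p : IndepPair L) :
    lower F (Finsupp.single p 1) = ∑ C ∈ p.down, Finsupp.single (toggle C p) 1 := by
  simp [lower]

lemma weight_single (p : IndepPair L) :
    weight F (Finsupp.single p 1) = ((#p.1.1 : F) - #p.1.2) • Finsupp.single p 1 := by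
  simp [weight]

lemma linearMap_ext {N : Type*} [AddCommMonoid N] [Module F N]
    {f g : (IndepPair L →₀ F) →ₗ[F] N}
    (h : ∀ p, f (Finsupp.single p 1) = g (Finsupp.single p 1)) : f = g :=
  Finsupp.lhom_ext' fun p => LinearMap.ext_ring (h p)

lemma raise_lower_single (p : IndepPair L) :
    raise F (lower F (Finsupp.single p 1)) = (#p.down : F) • Finsupp.single p 1 +
      ∑ C ∈ p.down, ∑ C' ∈ p.up, Finsupp.single (toggle C' (toggle C p)) 1 := by
  rw [lower_single, map_sum]
  simp only [raise_single]
  rw [sum_congr rfl fun C hC => by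
    rw [up_toggle hC, sum_insert (notMem_up_of_mem_down hC), toggle_toggle (mem_down.1 hC).1],
    sum_add_distrib, sum_const, Nat.cast_smul_eq_nsmul]

lemma lower_raise_single (p : IndepPair L) :
    lower F (raise F (Finsupp.single p 1)) = (#p.up : F) • Finsupp.single p 1 +
      ∑ C ∈ p.up, ∑ C' ∈ p.down, Finsupp.single (toggle C' (toggle C p)) 1 := by
  rw [raise_single, map_sum]
  simp only [lower_single]
  rw [sum_congr rfl fun C hC => by
    rw [down_toggle hC, sum_insert (notMem_down_of_mem_up hC), toggle_toggle (mem_up.1 hC).1],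
    sum_add_distrib, sum_const, Nat.cast_smul_eq_nsmul]

lemma commutator_raise_lower (hL : ClawFree L) :
    raise (L := L) F * lower F - lower F * raise F = weight F := by
  refine linearMap_ext fun p => ?_
  rw [LinearMap.sub_apply, Module.End.mul_apply, Module.End.mul_apply,
    raise_lower_single, lower_raise_single, weight_single, sum_comm (s := p.down)]
  have hswap : ∑ C ∈ p.up, ∑ C' ∈ p.down, Finsupp.single (toggle C (toggle C' p)) (1 : F) =
      ∑ C ∈ p.up, ∑ C' ∈ p.down, Finsupp.single (toggle C' (toggle C p)) 1 :=
    sum_congr rfl fun C hC => sum_congr rfl fun C' hC' => by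
      rw [toggle_comm (mem_up.1 hC).1 (mem_down.1 hC').1]
  have hcard : (#p.up : F) + #p.1.1 = #p.down + #p.1.2 := by
    exact_mod_cast congrArg (Nat.cast : ℕ → F) (card_up_add_card_fst hL p)
  rw [hswap, add_sub_add_right_eq_sub, ← sub_smul]
  congr 1
  linear_combination -hcard

lemma commutator_weight_raise (hL : ClawFree L) :
    weight (L := L) F * raise F - raise F * weight F = 2 • raise F := by
  refine linearMap_ext fun p => ?_
  rw [LinearMap.sub_apply, Module.End.mul_apply, Module.End.mul_apply,
    LinearMap.smul_apply, weight_single, map_smul, raise_single, map_sum, smul_sum, smul_sum,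
    ← sum_sub_distrib]
  refine sum_congr rfl fun C hC => ?_
  obtain ⟨h₁, h₂⟩ := card_toggle_of_mem_up hL hC
  rw [weight_single, ← sub_smul, h₁, ← h₂, ← Nat.cast_smul_eq_nsmul F]
  congr 1
  push_cast
  ring

lemma commutator_weight_lower (hL : ClawFree L) :
    weight (L := L) F * lower F - lower F * weight F = -(2 • lower F) := by
  refine linearMap_ext fun p => ?_
  rw [LinearMap.sub_apply, Module.End.mul_apply, Module.End.mul_apply,
    LinearMap.neg_apply, LinearMap.smul_apply, weight_single, map_smul, lower_single, map_sum,
    smul_sum, smul_sum, ← sum_sub_distrib, ← sum_neg_distrib]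
  refine sum_congr rfl fun C hC => ?_
  obtain ⟨h₁, h₂⟩ := card_toggle_of_mem_down hL hC
  rw [weight_single, ← sub_smul, ← h₁, h₂, ← Nat.cast_smul_eq_nsmul F, ← neg_smul]
  congr 1
  push_cast
  ring

/-- The raising operator is injective on vectors of negative weight. -/
lemma eq_zero_of_raise_eq_zero [CharZero F] [Finite E] (hL : ClawFree L) {m : ℕ} (hm : 0 < m)
    {x : IndepPair L →₀ F} (hx : weight F x = -(m : F) • x) (h : raise F x = 0) : x = 0 := by
  by_contra hne
  have hm' : (m : F) ≠ 0 := Nat.cast_ne_zero.2 hm.ne'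
  have ht : IsSl2Triple (L := Module.End F (IndepPair L →₀ F)) (weight F) (raise F) (lower F) :=
    { h_ne_zero := fun h0 => by
        rw [h0, LinearMap.zero_apply, eq_comm, smul_eq_zero, neg_eq_zero] at hx
        exact hx.elim hm' hne
      lie_e_f := commutator_raise_lower hL
      lie_h_e_nsmul := commutator_weight_raise hL
      lie_h_f_nsmul := commutator_weight_lower hL }
  obtain ⟨n, hn⟩ := IsSl2Triple.HasPrimitiveVectorWith.exists_nat
    (⟨hne, hx, h⟩ : ht.HasPrimitiveVectorWith x (-(m : F)))
  have : ((m + n : ℕ) : F) = 0 := by push_cast; linear_combination -hn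
  rw [Nat.cast_eq_zero] at this
  omega

end IndepPair

end ClawFree

section Matchings

open Finset SimpleGraph IndepPair
open scoped Classical TensorProduct

variable {V : Type*} {G : SimpleGraph V}

lemma isEdgeMatching_iff_isIndepSet {M : Finset G.edgeSet} :
    IsEdgeMatching G M ↔ G.lineGraph.IsIndepSet M := by
  constructor
  · rintro h e he f hf hne ⟨-, v, hv, hv'⟩
    exact h e he f hf hne v hv hv'
  · intro h e he f hf hne v hv hv'
    exact h he hf hne ⟨hne, v, hv, hv'⟩

lemma clawFree_lineGraph (G : SimpleGraph V) : ClawFree G.lineGraph := by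
  intro A hA e
  rw [← isEdgeMatching_iff_isIndepSet] at hA
  have hex : ∀ f ∈ A.filter fun f => G.lineGraph.Adj e f,
      ∃ v, v ∈ (e : Sym2 V) ∧ v ∈ (f : Sym2 V) := fun f hf => (mem_filter.1 hf).2.2
  have : Nonempty V := ⟨(e : Sym2 V).out.1⟩
  choose! v hve hvf using hex
  refine le_trans (card_le_card_of_injOn (t := (e : Sym2 V).toFinset) v ?_ ?_) ?_
  · intro f hf
    simpa using hve f hf
  · intro f hf f' hf' heq
    by_contra hne
    exact hA f (mem_filter.1 hf).1 f' (mem_filter.1 hf').1 hne (v f) (hvf f hf)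
      (heq ▸ hvf f' hf')
  · rw [Sym2.card_toFinset]
    split_ifs <;> omega

/-- The automorphism of the line graph induced by an automorphism of the graph. -/
def lineGraphIso (σ : G ≃g G) : G.lineGraph ≃g G.lineGraph where
  toEquiv := σ.mapEdgeSet
  map_rel_iff' {e f} := by
    refine and_congr (σ.mapEdgeSet.injective.ne_iff) ?_
    constructor
    · rintro ⟨v, hv, hv'⟩
      obtain ⟨w, hw, rfl⟩ := Sym2.mem_map.1 hv
      obtain ⟨u, hu, huw⟩ := Sym2.mem_map.1 hv'
      exact ⟨w, hw, by rwa [← σ.injective huw]⟩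
    · rintro ⟨v, hv, hv'⟩
      exact ⟨σ v, Sym2.mem_map.2 ⟨v, hv, rfl⟩, Sym2.mem_map.2 ⟨v, hv', rfl⟩⟩

/-- Two matchings form a pair of independent sets of the line graph. -/
def matchingPair {i j : ℕ} (M : Matchings G i) (M' : Matchings G j) :
    IndepPair G.lineGraph :=
  ⟨(M.1, M'.1), isEdgeMatching_iff_isIndepSet.1 M.2.1, isEdgeMatching_iff_isIndepSet.1 M'.2.1⟩

lemma matchingPair_map (σ : G ≃g G) {i j : ℕ} (M : Matchings G i) (M' : Matchings G j) :
    matchingPair (matchingsMap σ M) (matchingsMap σ M') =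
      IndepPair.map (lineGraphIso σ) (matchingPair M M') := by
  refine IndepPair.ext ?_ ?_ <;>
  · ext e
    simp only [matchingPair, matchingsMap, IndepPair.map, mem_image]
    rfl

lemma exists_matchingPair {i j : ℕ} {p : IndepPair G.lineGraph} (h₁ : #p.1.1 = i)
    (h₂ : #p.1.2 = j) : ∃ (M : Matchings G i) (M' : Matchings G j), matchingPair M M' = p :=
  ⟨⟨p.1.1, isEdgeMatching_iff_isIndepSet.2 p.2.1, h₁⟩,
    ⟨p.1.2, isEdgeMatching_iff_isIndepSet.2 p.2.2, h₂⟩, rfl⟩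

variable (F : Type*) [Field F]

/-- The embedding of `V_i ⊗ V_j` into the span of all pairs of independent edge sets. -/
noncomputable def pairEmbedding (G : SimpleGraph V) (i j : ℕ) :
    MatchRep F G i ⊗[F] MatchRep F G j →ₗ[F] (IndepPair G.lineGraph →₀ F) :=
  Finsupp.lmapDomain F F (fun q : Matchings G i × Matchings G j => matchingPair q.1 q.2) ∘ₗ
    (finsuppTensorFinsupp' F (Matchings G i) (Matchings G j)).toLinearMap

/-- The basis vector of `V_i ⊗ V_j` given by a pair of matchings, zero if the sizes are wrong. -/
noncomputable def pairTensor (i j : ℕ) (p : IndepPair G.lineGraph) :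
    MatchRep F G i ⊗[F] MatchRep F G j :=
  if h : #p.1.1 = i ∧ #p.1.2 = j then
    Finsupp.single ⟨p.1.1, isEdgeMatching_iff_isIndepSet.2 p.2.1, h.1⟩ 1 ⊗ₜ
      Finsupp.single ⟨p.1.2, isEdgeMatching_iff_isIndepSet.2 p.2.2, h.2⟩ 1
  else 0

/-- The average of all pairs of matchings obtained by toggling a component that favours the
second matching. -/
noncomputable def averageToggle (G : SimpleGraph V) (i k : ℕ) :
    MatchRep F G i ⊗[F] MatchRep F G (k + 1) →ₗ[F] MatchRep F G (i + 1) ⊗[F] MatchRep F G k :=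
  Finsupp.linearCombination F (fun q : Matchings G i × Matchings G (k + 1) =>
      (#(matchingPair q.1 q.2).up : F)⁻¹ •
        ∑ C ∈ (matchingPair q.1 q.2).up, pairTensor F (i + 1) k (toggle C (matchingPair q.1 q.2)))
    ∘ₗ (finsuppTensorFinsupp' F (Matchings G i) (Matchings G (k + 1))).toLinearMap

variable {F} {i j k : ℕ}

lemma matchRep_tensor_ext {N : Type*} [AddCommMonoid N] [Module F N]
    {f g : MatchRep F G i ⊗[F] MatchRep F G j →ₗ[F] N}
    (h : ∀ M M', f (Finsupp.single M 1 ⊗ₜ Finsupp.single M' 1) =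
      g (Finsupp.single M 1 ⊗ₜ Finsupp.single M' 1)) : f = g := by
  ext M M'
  exact h M M'

lemma pairEmbedding_injective : Function.Injective (pairEmbedding F G i j) := by
  refine (Finsupp.mapDomain_injective ?_).comp
    (finsuppTensorFinsupp' F (Matchings G i) (Matchings G j)).injective
  rintro ⟨M, M'⟩ ⟨N, N'⟩ h
  have h' := Prod.ext_iff.1 (Subtype.ext_iff.1 h)
  exact Prod.ext (Subtype.ext h'.1) (Subtype.ext h'.2)

lemma pairEmbedding_single (M : Matchings G i) (M' : Matchings G j) :
    pairEmbedding F G i j (Finsupp.single M 1 ⊗ₜ Finsupp.single M' 1) =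
      Finsupp.single (matchingPair M M') 1 := by
  simp [pairEmbedding]

lemma pairTensor_matchingPair (M : Matchings G i) (M' : Matchings G j) :
    pairTensor F i j (matchingPair M M') = Finsupp.single M 1 ⊗ₜ Finsupp.single M' 1 :=
  dif_pos ⟨M.2.2, M'.2.2⟩

lemma averageToggle_single (M : Matchings G i) (M' : Matchings G (k + 1)) :
    averageToggle F G i k (Finsupp.single M 1 ⊗ₜ Finsupp.single M' 1) =
      (#(matchingPair M M').up : F)⁻¹ • ∑ C ∈ (matchingPair M M').up,
        pairTensor F (i + 1) k (toggle C (matchingPair M M')) := by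
  simp [averageToggle]

lemma exists_matchingPair_toggle {M : Matchings G i} {M' : Matchings G (k + 1)}
    {C : Finset G.edgeSet} (hC : C ∈ (matchingPair M M').up) :
    ∃ (N : Matchings G (i + 1)) (N' : Matchings G k),
      matchingPair N N' = toggle C (matchingPair M M') := by
  obtain ⟨h₁, h₂⟩ := card_toggle_of_mem_up (clawFree_lineGraph G) hC
  refine exists_matchingPair (h₁.trans (congrArg (· + 1) M.2.2)) ?_
  exact Nat.succ_injective (h₂.trans M'.2.2)

lemma card_up_matchingPair_pos (h : i < j) (M : Matchings G i) (M' : Matchings G j) :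
    0 < #(matchingPair M M').up := by
  have := card_up_add_card_fst (clawFree_lineGraph G) (matchingPair M M')
  have h₁ : #(matchingPair M M').1.1 = i := M.2.2
  have h₂ : #(matchingPair M M').1.2 = j := M'.2.2
  omega

lemma averageToggle_equivariant (σ : G ≃g G) :
    averageToggle F G i k ∘ₗ TensorProduct.map (actV F σ i) (actV F σ (k + 1)) =
      TensorProduct.map (actV F σ (i + 1)) (actV F σ k) ∘ₗ averageToggle F G i k := by
  refine matchRep_tensor_ext fun M M' => ?_
  have hact (n : ℕ) (N : Matchings G n) :
      actV F σ n (Finsupp.single N 1) = Finsupp.single (matchingsMap σ N) 1 := by simp [actV]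
  simp only [LinearMap.comp_apply, TensorProduct.map_tmul, hact, averageToggle_single, map_smul,
    map_sum, matchingPair_map, card_up_map, sum_up_map]
  congr 1
  refine sum_congr rfl fun C hC => ?_
  obtain ⟨N, N', hN⟩ := exists_matchingPair_toggle hC
  rw [toggle_map _ (mem_up.1 hC).1, ← hN, ← matchingPair_map, pairTensor_matchingPair,
    pairTensor_matchingPair, TensorProduct.map_tmul, hact, hact]

lemma PiMap_single (M : Matchings G i) (M' : Matchings G j) :
    PiMap F G i j (Finsupp.single M 1 ⊗ₜ Finsupp.single M' 1) =
      (∏ e ∈ (matchingPair M M').1.1, MvPolynomial.X e) *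
        ∏ e ∈ (matchingPair M M').1.2, MvPolynomial.X e := by
  simp [PiMap, matchingPair]

lemma PiMap_comp_averageToggle [CharZero F] (h : i < k + 1) :
    PiMap F G (i + 1) k ∘ₗ averageToggle F G i k = PiMap F G i (k + 1) := by
  refine matchRep_tensor_ext fun M M' => ?_
  rw [LinearMap.comp_apply, averageToggle_single, map_smul, map_sum, PiMap_single]
  have hterm : ∀ C ∈ (matchingPair M M').up,
      PiMap F G (i + 1) k (pairTensor F (i + 1) k (toggle C (matchingPair M M'))) =
        (∏ e ∈ (matchingPair M M').1.1, MvPolynomial.X e) *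
          ∏ e ∈ (matchingPair M M').1.2, MvPolynomial.X e := by
    intro C hC
    obtain ⟨N, N', hN⟩ := exists_matchingPair_toggle hC
    rw [← hN, pairTensor_matchingPair, PiMap_single, hN, prod_mul_prod_toggle]
  have hpos : (#(matchingPair M M').up : F) ≠ 0 :=
    Nat.cast_ne_zero.2 (card_up_matchingPair_pos h M M').ne'
  rw [sum_congr rfl hterm, sum_const, ← Nat.cast_smul_eq_nsmul F, smul_smul,
    inv_mul_cancel₀ hpos, one_smul]

/-- The diagonal operator dividing each pair by the number of its components that favour the
second member. -/
noncomputable def averageScale (F : Type*) [Field F] (G : SimpleGraph V) :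
    (IndepPair G.lineGraph →₀ F) →ₗ[F] (IndepPair G.lineGraph →₀ F) :=
  Finsupp.linearCombination F fun p => (#p.up : F)⁻¹ • Finsupp.single p 1

lemma averageScale_single (p : IndepPair G.lineGraph) :
    averageScale F G (Finsupp.single p 1) = (#p.up : F)⁻¹ • Finsupp.single p 1 := by
  simp [averageScale]

lemma pairEmbedding_comp_averageToggle :
    pairEmbedding F G (i + 1) k ∘ₗ averageToggle F G i k =
      raise F ∘ₗ averageScale F G ∘ₗ pairEmbedding F G i (k + 1) := by
  refine matchRep_tensor_ext fun M M' => ?_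
  simp only [LinearMap.comp_apply]
  rw [averageToggle_single, pairEmbedding_single, averageScale_single, map_smul, map_smul,
    raise_single, map_sum]
  congr 1
  refine sum_congr rfl fun C hC => ?_
  obtain ⟨N, N', hN⟩ := exists_matchingPair_toggle hC
  rw [← hN, pairTensor_matchingPair, pairEmbedding_single]

lemma averageScale_comp_pairEmbedding_injective [CharZero F] (h : i < j) :
    Function.Injective (averageScale F G ∘ₗ pairEmbedding F G i j) := by
  let unscale : (IndepPair G.lineGraph →₀ F) →ₗ[F] (IndepPair G.lineGraph →₀ F) :=
    Finsupp.linearCombination F fun p => (#p.up : F) • Finsupp.single p 1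
  have hcomp : unscale ∘ₗ averageScale F G ∘ₗ pairEmbedding F G i j = pairEmbedding F G i j := by
    refine matchRep_tensor_ext fun M M' => ?_
    have hpos : (#(matchingPair M M').up : F) ≠ 0 :=
      Nat.cast_ne_zero.2 (card_up_matchingPair_pos h M M').ne'
    simp only [LinearMap.comp_apply]
    rw [pairEmbedding_single, averageScale_single, map_smul, Finsupp.linearCombination_single,
      one_smul, smul_smul, inv_mul_cancel₀ hpos, one_smul]
  have hinj := pairEmbedding_injective (F := F) (G := G) (i := i) (j := j)
  rw [← hcomp, LinearMap.coe_comp] at hinj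
  exact hinj.of_comp

lemma weight_averageScale_pairEmbedding {m : ℕ} (h : j = i + m)
    (x : MatchRep F G i ⊗[F] MatchRep F G j) :
    weight F (averageScale F G (pairEmbedding F G i j x)) =
      -(m : F) • averageScale F G (pairEmbedding F G i j x) := by
  suffices heq : weight F ∘ₗ averageScale F G ∘ₗ pairEmbedding F G i j =
      -(m : F) • (averageScale F G ∘ₗ pairEmbedding F G i j) from LinearMap.congr_fun heq x
  refine matchRep_tensor_ext fun M M' => ?_
  have h₁ : #(matchingPair M M').1.1 = i := M.2.2
  have h₂ : #(matchingPair M M').1.2 = j := M'.2.2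
  simp only [LinearMap.comp_apply, LinearMap.smul_apply]
  rw [pairEmbedding_single, averageScale_single, map_smul, weight_single, smul_comm, h₁, h₂]
  congr 1
  rw [h]
  push_cast
  ring

lemma averageToggle_injective [CharZero F] [Finite V] (h : i < k + 1) :
    Function.Injective (averageToggle F G i k) := by
  intro x y hxy
  apply averageScale_comp_pairEmbedding_injective h
  rw [LinearMap.comp_apply, LinearMap.comp_apply, ← sub_eq_zero]
  have hw := weight_averageScale_pairEmbedding (F := F) (G := G) (i := i) (j := k + 1)
    (m := k + 1 - i) (by omega)
  refine eq_zero_of_raise_eq_zero (clawFree_lineGraph G) (Nat.sub_pos_of_lt h) ?_ ?_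
  · rw [map_sub, hw, hw, smul_sub]
  · have hraise := LinearMap.congr_fun (pairEmbedding_comp_averageToggle (F := F) (G := G)
      (i := i) (k := k))
    simp only [LinearMap.comp_apply] at hraise
    rw [map_sub, ← hraise, ← hraise, hxy, sub_self]

end Matchings

/-- For every finite simple graph `G` and `1 ≤ ℓ ≤ k`, there is an injective,
`Aut(G)`-equivariant linear map `Φ : V_{ℓ-1} ⊗ V_{k+1} → V_ℓ ⊗ V_k` with
`Π_{ℓ,k} ∘ Φ = Π_{ℓ-1,k+1}`. -/
theorem equivariant_injection_compatible_with_Pi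
    (F : Type) [Field F] [CharZero F]
    (V : Type) [Fintype V] [DecidableEq V] (G : SimpleGraph V)
    (ℓ k : ℕ) (hℓ : 1 ≤ ℓ) (hℓk : ℓ ≤ k) :
    ∃ Φ : TensorProduct F (MatchRep F G (ℓ - 1)) (MatchRep F G (k + 1)) →ₗ[F]
          TensorProduct F (MatchRep F G ℓ) (MatchRep F G k),
      Function.Injective Φ ∧
      (∀ σ : G ≃g G,
        Φ ∘ₗ TensorProduct.map (actV F σ (ℓ - 1)) (actV F σ (k + 1)) =
          TensorProduct.map (actV F σ ℓ) (actV F σ k) ∘ₗ Φ) ∧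
      PiMap F G ℓ k ∘ₗ Φ = PiMap F G (ℓ - 1) (k + 1) := by
  obtain ⟨i, rfl⟩ := Nat.exists_eq_add_of_le' hℓ
  have hik : i < k + 1 := by omega
  exact ⟨averageToggle F G i k, averageToggle_injective hik, averageToggle_equivariant,
    PiMap_comp_averageToggle hik⟩
end
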